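/- Convergence of the variance to γ: Let f : 𝕋 → 𝕋 be a C^∞ map of the circle with f' ≥ λ for some λ > 1, let ρ⋆ be the density of its unique absolutely continuous invariant probability measure, and let b ∈ C^∞(𝕋,ℝ) with ∫_𝕋 b ρ⋆ dθ = 0. Then the series γ = ∫_𝕋 b² ρ⋆ dθ + 2∑_{k=1}^∞ ∫_𝕋 b·(b∘f^k)·ρ⋆ dθ converges absolutely, and there exists a constant C (depending on f and b) such that for every n ≥ 1: | (1/n) ∫_𝕋 ( ∑_{k=0}^{n−1} b(f^k(θ)) )² ρ⋆(θ) dθ − γ | ≤ C/n. -/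

import Mathlib

/-!
Statement 17: Convergence of the variance to `γ` (Lemma B.1 of the paper):
the Green–Kubo series defining `γ` converges absolutely and
`| n⁻¹ ‖∑_{k<n} b∘f^k‖²_{L²(ρ⋆)} − γ | ≤ C/n`.
-/

open MeasureTheory Filter

noncomputable section

/-- The Green–Kubo covariance
`γ = ∫ b² ρ⋆ + 2 ∑_{k≥1} ∫ b (b∘f^k) ρ⋆`. -/
def gammaCoef (F b ρstar : ℝ → ℝ) : ℝ :=
  (∫ x in (0:ℝ)..1, b x ^ 2 * ρstar x)
    + 2 * ∑' k : ℕ, ∫ x in (0:ℝ)..1, b x * b (F^[k + 1] x) * ρstar x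

/-- Nonnegative continuous functions of period `1` whose logarithm is `A`-Lipschitz
(or which vanish identically). -/
structure IsLogLipschitz (A : ℝ) (h : ℝ → ℝ) : Prop where
  continuous : Continuous h
  periodic : Function.Periodic h 1
  nonneg : ∀ x, 0 ≤ h x
  le_exp_mul : ∀ x y, h x ≤ Real.exp (A * |x - y|) * h y

lemma Function.Periodic.exists_abs_le {g : ℝ → ℝ} (hper : Function.Periodic g 1)
    (hg : Continuous g) : ∃ M, 0 ≤ M ∧ ∀ x, |g x| ≤ M := by
  obtain ⟨M, hM⟩ := isCompact_Icc.exists_bound_of_continuousOn (s := Set.Icc (0 : ℝ) 1)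
    hg.continuousOn
  refine ⟨M, (norm_nonneg _).trans (hM 0 (by simp)), fun x => ?_⟩
  obtain ⟨y, hy, hxy⟩ := hper.exists_mem_Ico₀ one_pos x
  rw [hxy]
  exact hM y ⟨hy.1, hy.2.le⟩

lemma Function.Periodic.deriv_of_add_const {F : ℝ → ℝ} {d : ℝ} (h : ∀ x, F (x + 1) = F x + d) :
    Function.Periodic (deriv F) 1 := by
  intro x
  rw [← deriv_comp_add_const, funext h, deriv_add_const]

lemma IsLogLipschitz.mono {A A' : ℝ} {h : ℝ → ℝ} (hh : IsLogLipschitz A h) (hA : A ≤ A') :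
    IsLogLipschitz A' h where
  continuous := hh.continuous
  periodic := hh.periodic
  nonneg := hh.nonneg
  le_exp_mul x y := (hh.le_exp_mul x y).trans <| by
    have := hh.nonneg y
    gcongr

lemma IsLogLipschitz.const_mul {A c : ℝ} {h : ℝ → ℝ} (hh : IsLogLipschitz A h) (hc : 0 ≤ c) :
    IsLogLipschitz A (fun x => c * h x) where
  continuous := hh.continuous.const_mul c
  periodic x := by simp only [hh.periodic x]
  nonneg x := mul_nonneg hc (hh.nonneg x)
  le_exp_mul x y := by
    have := mul_le_mul_of_nonneg_left (hh.le_exp_mul x y) hc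
    linarith

lemma exists_isLogLipschitz {h : ℝ → ℝ} (hC : ContDiff ℝ 1 h) (hper : Function.Periodic h 1)
    (hpos : ∀ x, 0 < h x) : ∃ A, 0 ≤ A ∧ IsLogLipschitz A h := by
  have hlog : ContDiff ℝ 1 (fun x => Real.log (h x)) := hC.log fun x => (hpos x).ne'
  have hlogper : ∀ x, Real.log (h (x + 1)) = Real.log (h x) + 0 := fun x => by
    rw [hper x, add_zero]
  obtain ⟨A, hA, hbound⟩ := (Function.Periodic.deriv_of_add_const hlogper).exists_abs_le
    (hlog.continuous_deriv le_rfl)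
  refine ⟨A, hA, hC.continuous, hper, fun x => (hpos x).le, fun x y => ?_⟩
  have key := Convex.norm_image_sub_le_of_norm_deriv_le (s := Set.univ) (x := y) (y := x)
    (fun z _ => (hlog.differentiable one_ne_zero) z) (fun z _ => hbound z) convex_univ
    (Set.mem_univ _) (Set.mem_univ _)
  simp only [Real.norm_eq_abs] at key
  rw [← Real.log_le_log_iff (hpos x) (by have := hpos y; positivity),
    Real.log_mul (Real.exp_pos _).ne' (hpos y).ne', Real.log_exp]
  linarith [le_abs_self (Real.log (h x) - Real.log (h y))]

lemma IsLogLipschitz.exp_neg_le {A : ℝ} {u : ℝ → ℝ} (hu : IsLogLipschitz A u) (hA : 0 ≤ A)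
    (hmean : (∫ x in (0 : ℝ)..1, u x) = 1) (y : ℝ) : Real.exp (-A) ≤ u y := by
  obtain ⟨z, hz, hyz⟩ := hu.periodic.exists_mem_Ico₀ one_pos y
  rw [hyz]
  have key : (∫ x in (0 : ℝ)..1, u x) ≤ ∫ _ in (0 : ℝ)..1, Real.exp A * u z := by
    refine intervalIntegral.integral_mono_on zero_le_one
      (hu.continuous.intervalIntegrable _ _) (by simp) fun x hx => ?_
    have hxz : |x - z| ≤ 1 := abs_le.2 ⟨by linarith [hx.1, hz.2], by linarith [hx.2, hz.1]⟩
    refine (hu.le_exp_mul x z).trans (mul_le_mul_of_nonneg_right ?_ (hu.nonneg z))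
    exact Real.exp_le_exp.2 (mul_le_of_le_one_right hA hxz)
  rw [hmean] at key
  simp only [intervalIntegral.integral_const, sub_zero, one_smul] at key
  rwa [Real.exp_neg, inv_le_iff_one_le_mul₀' (Real.exp_pos _)]

/-- A density with `θ A`-Lipschitz logarithm stays in the class with constant `A` after subtracting
a fixed constant and renormalising. -/
lemma IsLogLipschitz.sub_const {A θ : ℝ} {u : ℝ → ℝ} (hu : IsLogLipschitz (θ * A) u)
    (hA : 0 ≤ A) (hθ0 : 0 ≤ θ) (hθ1 : θ ≤ 1) (hmean : (∫ x in (0 : ℝ)..1, u x) = 1) :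
    IsLogLipschitz A (fun x => u x - (1 - θ) * Real.exp (-A)) where
  continuous := hu.continuous.sub continuous_const
  periodic x := by simp only [hu.periodic x]
  nonneg x := by
    have := (hu.mono (mul_le_of_le_one_left hA hθ1)).exp_neg_le hA hmean x
    nlinarith [Real.exp_pos (-A)]
  le_exp_mul x y := by
    have hy := (hu.mono (mul_le_of_le_one_left hA hθ1)).exp_neg_le hA hmean y
    have hx := hu.le_exp_mul x y
    set t := |x - y|
    have ht : 0 ≤ t := abs_nonneg _
    have hconv : Real.exp (θ * A * t) ≤ θ * Real.exp (A * t) + (1 - θ) := by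
      have := convexOn_exp.2 (Set.mem_univ (A * t)) (Set.mem_univ 0) hθ0
        (sub_nonneg.2 hθ1) (by ring)
      simpa [mul_assoc] using this
    have h1 : 1 ≤ Real.exp (A * t) := Real.one_le_exp (mul_nonneg hA ht)
    have h2 : 0 ≤ (1 - θ) * (Real.exp (A * t) - 1) :=
      mul_nonneg (sub_nonneg.2 hθ1) (sub_nonneg.2 h1)
    have h3 := mul_le_mul_of_nonneg_left hy h2
    have h4 := mul_le_mul_of_nonneg_right hconv (hu.nonneg y)
    linarith

lemma intervalIntegral_eq_sum_translates {φ : ℝ → ℝ} (hφ : Continuous φ) (N : ℕ)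
    (hper : Function.Periodic φ N) (a : ℝ) :
    (∫ x in a..a + N, φ x) = ∫ x in (0 : ℝ)..1, ∑ j ∈ Finset.range N, φ (x + j) := by
  have hsum := intervalIntegral.sum_integral_adjacent_intervals (f := φ) (μ := volume)
    (a := fun k : ℕ => (k : ℝ)) (n := N) fun k _ => hφ.intervalIntegrable _ _
  rw [hper.intervalIntegral_add_eq a 0, intervalIntegral.integral_finsetSum]
  · simp only [intervalIntegral.integral_comp_add_right]
    simpa [add_comm] using hsum.symm
  · exact fun j _ => (hφ.comp (continuous_id.add continuous_const)).intervalIntegrable _ _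

/-- The transfer operator of an expanding circle map, applied to a density `h`. -/
lemma IsLogLipschitz.exists_transfer {F : ℝ → ℝ} (hF : ContDiff ℝ 1 F) {N : ℕ}
    (hlift : ∀ x, F (x + 1) = F x + N) {lam : ℝ} (hlam : 0 < lam)
    (hexp : ∀ x, lam ≤ deriv F x) {A B : ℝ} (hA : 0 ≤ A) (hB : 0 ≤ B)
    (hw : IsLogLipschitz B (fun x => (deriv F x)⁻¹)) {h : ℝ → ℝ} (hh : IsLogLipschitz A h) :
    ∃ u, IsLogLipschitz ((A + B) / lam) u ∧
      ∀ g : ℝ → ℝ, Continuous g → Function.Periodic g 1 →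
        (∫ x in (0 : ℝ)..1, h x * g (F x)) = ∫ x in (0 : ℝ)..1, u x * g x := by
  have hdiff : Differentiable ℝ F := hF.differentiable one_ne_zero
  have hgrow := mul_sub_le_image_sub_of_le_deriv hdiff hexp
  have hmono : StrictMono F := fun x y hxy => by
    have := hgrow hxy.le
    nlinarith [mul_pos hlam (sub_pos.2 hxy)]
  have hsurj : Function.Surjective F := by
    refine hF.continuous.surjective ?_ ?_
    · refine tendsto_atTop_mono' atTop (f₁ := fun x => lam * x + F 0) ?_
        (tendsto_atTop_add_const_right _ _ (tendsto_id.const_mul_atTop hlam))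
      filter_upwards [eventually_ge_atTop 0] with x hx
      linarith [hgrow hx]
    · refine tendsto_atBot_mono' atBot (f₁ := fun x => lam * x + F 0) ?_
        (tendsto_atBot_add_const_right _ _ (tendsto_id.const_mul_atBot hlam))
      filter_upwards [eventually_le_atBot 0] with x hx
      have := hgrow hx
      linarith
  let e := hmono.orderIsoOfSurjective F hsurj
  let H : ℝ → ℝ := fun y => e.symm y
  have hH : Continuous H := e.symm.continuous
  have hHF : ∀ x, H (F x) = x := fun x => e.symm_apply_apply x
  have hFH : ∀ x, F (H x) = x := fun x => e.apply_symm_apply x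
  have hHlift : ∀ y, H (y + N) = H y + 1 := fun y => by
    rw [← hHF (H y + 1), hlift, hFH]
  have hHlip : ∀ x y, |H x - H y| ≤ |x - y| / lam := by
    intro x y
    rw [le_div_iff₀ hlam]
    wlog hxy : y ≤ x generalizing x y
    · rw [abs_sub_comm, abs_sub_comm x]
      exact this y x (le_of_not_ge hxy)
    have h1 : H y ≤ H x := e.symm.monotone hxy
    have h2 := hgrow h1
    rw [hFH, hFH] at h2
    rw [abs_of_nonneg (sub_nonneg.2 h1), abs_of_nonneg (sub_nonneg.2 hxy)]
    linarith
  set ψ : ℝ → ℝ := fun y => h (H y) * (deriv F (H y))⁻¹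
  have hψcont : Continuous ψ := (hh.continuous.comp hH).mul (hw.continuous.comp hH)
  have hψper : Function.Periodic ψ N := fun y => by
    have h1 := hw.periodic (H y)
    simp only [ψ, hHlift, hh.periodic (H y)]
    exact congrArg _ h1
  have hψle : ∀ x y, ψ x ≤ Real.exp ((A + B) / lam * |x - y|) * ψ y := by
    intro x y
    have h1 := mul_le_mul (hh.le_exp_mul (H x) (H y)) (hw.le_exp_mul (H x) (H y)) (hw.nonneg _)
      (mul_nonneg (Real.exp_pos _).le (hh.nonneg _))
    have h2 : Real.exp (A * |H x - H y|) * Real.exp (B * |H x - H y|)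
        ≤ Real.exp ((A + B) / lam * |x - y|) := by
      rw [← Real.exp_add]
      apply Real.exp_le_exp.2
      have := mul_le_mul_of_nonneg_left (hHlip x y) (add_nonneg hA hB)
      calc _ = (A + B) * |H x - H y| := by ring
        _ ≤ _ := this
        _ = _ := by ring
    have h3 : 0 ≤ ψ y := mul_nonneg (hh.nonneg _) (hw.nonneg _)
    calc ψ x ≤ Real.exp (A * |H x - H y|) * Real.exp (B * |H x - H y|) * ψ y := by
          simp only [ψ]; linarith
      _ ≤ _ := mul_le_mul_of_nonneg_right h2 h3
  refine ⟨fun y => ∑ j ∈ Finset.range N, ψ (y + j), ⟨?_, ?_, ?_, ?_⟩, ?_⟩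
  · exact continuous_finsetSum _ fun j _ => hψcont.comp (continuous_id.add continuous_const)
  · intro y
    have h1 := Finset.sum_range_succ' (fun j : ℕ => ψ (y + j)) N
    rw [Finset.sum_range_succ, hψper y] at h1
    simp only [Nat.cast_zero, add_zero, add_left_inj, Nat.cast_add, Nat.cast_one] at h1
    simp only [h1, add_assoc, add_comm (1 : ℝ)]
  · exact fun y => Finset.sum_nonneg fun j _ => mul_nonneg (hh.nonneg _) (hw.nonneg _)
  · intro x y
    rw [Finset.mul_sum]
    refine Finset.sum_le_sum fun j _ => ?_
    simpa using hψle (x + j) (y + j)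
  · intro g hg hgper
    have h1 := intervalIntegral.integral_comp_mul_deriv (a := 0) (b := 1) (f := F)
      (f' := deriv F) (g := fun y => ψ y * g y) (fun x _ => (hdiff x).hasDerivAt)
      (hF.continuous_deriv le_rfl).continuousOn (hψcont.mul hg)
    have h2 : F 1 = F 0 + N := by simpa using hlift 0
    have hgN : ∀ (j : ℕ) (x : ℝ), g (x + j) = g x := fun j x => by
      simpa using hgper.nat_mul j x
    rw [h2, intervalIntegral_eq_sum_translates (φ := fun y => ψ y * g y) (hψcont.mul hg) N
      (fun y => by simp only [hψper y, hgN])] at h1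
    simp only [hgN, ← Finset.sum_mul] at h1
    rw [← h1]
    refine intervalIntegral.integral_congr fun x _ => ?_
    have h3 : deriv F x ≠ 0 := (hlam.trans_le (hexp x)).ne'
    simp only [Function.comp, ψ, hHF]
    field_simp

lemma continuous_periodic_comp_iterate {F : ℝ → ℝ} (hF : Continuous F) {d : ℤ}
    (hlift : ∀ x, F (x + 1) = F x + d) {g : ℝ → ℝ} (hg : Continuous g)
    (hgper : Function.Periodic g 1) (k : ℕ) :
    Continuous (fun x => g (F^[k] x)) ∧ Function.Periodic (fun x => g (F^[k] x)) 1 := by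
  refine ⟨hg.comp (hF.iterate k), ?_⟩
  induction k with
  | zero => exact hgper
  | succ k ih =>
    intro x
    simp only [Function.iterate_succ_apply, hlift]
    simpa using ih.int_mul d (F x)

lemma exists_nat_degree {F : ℝ → ℝ} (hF : Differentiable ℝ F) {d : ℤ}
    (hlift : ∀ x, F (x + 1) = F x + d) {lam : ℝ} (hlam : 0 < lam)
    (hexp : ∀ x, lam ≤ deriv F x) : ∃ N : ℕ, d = N := by
  have h1 := mul_sub_le_image_sub_of_le_deriv hF hexp zero_le_one
  have h2 := hlift 0
  rw [zero_add] at h2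
  have h3 : (0 : ℝ) ≤ d := by linarith
  exact Int.eq_ofNat_of_zero_le (by exact_mod_cast h3)

/-- Exponential loss of memory for log-Lipschitz densities under an expanding circle map. -/
lemma exists_memory_loss {F : ℝ → ℝ} (hF : ContDiff ℝ (⊤ : ℕ∞) F) {d : ℤ}
    (hlift : ∀ x, F (x + 1) = F x + d) {lam : ℝ} (hlam : 1 < lam)
    (hexp : ∀ x, lam ≤ deriv F x) (A₀ : ℝ) :
    ∃ κ, 0 < κ ∧ κ < 1 ∧ ∀ (k : ℕ) (h₁ h₂ : ℝ → ℝ),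
      IsLogLipschitz A₀ h₁ → IsLogLipschitz A₀ h₂ →
      (∫ x in (0 : ℝ)..1, h₁ x) = 1 → (∫ x in (0 : ℝ)..1, h₂ x) = 1 →
      ∀ g : ℝ → ℝ, Continuous g → Function.Periodic g 1 → ∀ M, (∀ x, |g x| ≤ M) →
        |(∫ x in (0 : ℝ)..1, h₁ x * g (F^[k] x)) - ∫ x in (0 : ℝ)..1, h₂ x * g (F^[k] x)|
          ≤ 2 * M * κ ^ k := by
  have hlam0 : 0 < lam := by linarith
  have hF2 : ContDiff ℝ (1 + 1) F := hF.of_le (by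
    rw [one_add_one_eq_two]
    exact WithTop.coe_le_coe.2 (le_top : (2 : ℕ∞) ≤ ⊤))
  have hF1 : ContDiff ℝ 1 F := hF2.of_le (by norm_num)
  have hpos : ∀ x, 0 < deriv F x := fun x => hlam0.trans_le (hexp x)
  obtain ⟨N, rfl⟩ := exists_nat_degree (hF1.differentiable one_ne_zero) hlift hlam0 hexp
  have hderper := Function.Periodic.deriv_of_add_const hlift
  obtain ⟨B, hB, hw⟩ := exists_isLogLipschitz (h := fun x => (deriv F x)⁻¹)
    ((contDiff_succ_iff_deriv.1 hF2).2.2.inv fun x => (hpos x).ne')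
    (fun x => by simp only [hderper x]) (fun x => inv_pos.2 (hpos x))
  obtain ⟨A, hA1, hA0, hAB⟩ : ∃ A, 1 ≤ A ∧ A₀ ≤ A ∧ B < (lam - 1) * A := by
    refine ⟨max 1 (max A₀ ((B + 1) / (lam - 1))), le_max_left _ _,
      (le_max_left _ _).trans (le_max_right _ _), ?_⟩
    have h1 : (B + 1) / (lam - 1) ≤ max 1 (max A₀ ((B + 1) / (lam - 1))) :=
      (le_max_right _ _).trans (le_max_right _ _)
    rw [div_le_iff₀ (by linarith)] at h1
    linarith
  have hApos : 0 < A := by linarith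
  set θ := (A + B) / lam / A with hθ
  have hθ0 : 0 < θ := by positivity
  have hθ1 : θ < 1 := by
    rw [hθ, div_div, div_lt_one (by positivity)]
    linarith
  have hθA : (A + B) / lam = θ * A := by rw [hθ]; field_simp
  set ε := (1 - θ) * Real.exp (-A) with hε
  have hε0 : 0 < ε := mul_pos (by linarith) (Real.exp_pos _)
  have hε1 : ε < 1 := by
    have : Real.exp (-A) ≤ 1 := Real.exp_le_one_iff.2 (by linarith)
    nlinarith [Real.exp_pos (-A)]
  refine ⟨1 - ε, by linarith, by linarith, fun k h₁ h₂ hh₁ hh₂ => ?_⟩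
  replace hh₁ := hh₁.mono hA0
  replace hh₂ := hh₂.mono hA0
  have step : ∀ h : ℝ → ℝ, IsLogLipschitz A h → (∫ x in (0 : ℝ)..1, h x) = 1 →
      ∃ v : ℝ → ℝ, IsLogLipschitz A v ∧ (∫ x in (0 : ℝ)..1, v x) = 1 ∧
        ∀ g : ℝ → ℝ, Continuous g → Function.Periodic g 1 →
          (∫ x in (0 : ℝ)..1, h x * g (F x))
            = (1 - ε) * (∫ x in (0 : ℝ)..1, v x * g x) + ε * ∫ x in (0 : ℝ)..1, g x := by
    intro h hh hmean
    obtain ⟨u, hu, hdual⟩ := IsLogLipschitz.exists_transfer hF1 hlift hlam0 hexp hApos.le hB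
      hw hh
    have humean : (∫ x in (0 : ℝ)..1, u x) = 1 := by
      simpa [hmean] using (hdual (fun _ => (1 : ℝ)) continuous_const (fun _ => rfl)).symm
    rw [hθA] at hu
    have hv := hu.sub_const hApos.le hθ0.le hθ1.le humean
    have hε' : (1 - ε) ≠ 0 := by linarith
    refine ⟨fun x => (1 - ε)⁻¹ * (u x - ε),
      hv.const_mul (inv_nonneg.2 (by linarith)), ?_, fun g hg hgper => ?_⟩
    · rw [intervalIntegral.integral_const_mul, intervalIntegral.integral_sub
        (hu.continuous.intervalIntegrable _ _) (by simp), humean]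
      simp [hε']
    · rw [hdual g hg hgper]
      simp only [mul_assoc]
      rw [intervalIntegral.integral_const_mul, mul_inv_cancel_left₀ hε',
        ← intervalIntegral.integral_const_mul, ← intervalIntegral.integral_add]
      · congr 1
        ext x
        ring
      · exact ((hu.continuous.sub continuous_const).mul hg).intervalIntegrable _ _
      · exact (continuous_const.mul hg).intervalIntegrable _ _
  induction k generalizing h₁ h₂ with
  | zero =>
    intro hm₁ hm₂ g hg _ M hM
    have bound : ∀ h : ℝ → ℝ, IsLogLipschitz A h → (∫ x in (0 : ℝ)..1, h x) = 1 →
        |∫ x in (0 : ℝ)..1, h x * g x| ≤ M := by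
      intro h hh hmean
      calc |∫ x in (0 : ℝ)..1, h x * g x| ≤ ∫ x in (0 : ℝ)..1, |h x * g x| :=
            intervalIntegral.abs_integral_le_integral_abs zero_le_one
        _ ≤ ∫ x in (0 : ℝ)..1, h x * M := by
            refine intervalIntegral.integral_mono_on zero_le_one
              ((hh.continuous.mul hg).abs.intervalIntegrable _ _)
              ((hh.continuous.mul continuous_const).intervalIntegrable _ _) fun x _ => ?_
            rw [abs_mul, abs_of_nonneg (hh.nonneg x)]
            exact mul_le_mul_of_nonneg_left (hM x) (hh.nonneg x)
        _ = M := by rw [intervalIntegral.integral_mul_const, hmean, one_mul]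
    simp only [Function.iterate_zero, id_eq, pow_zero, mul_one]
    linarith [abs_sub (∫ x in (0 : ℝ)..1, h₁ x * g x) (∫ x in (0 : ℝ)..1, h₂ x * g x),
      bound h₁ hh₁ hm₁, bound h₂ hh₂ hm₂]
  | succ k ih =>
    intro hm₁ hm₂ g hg hgper M hM
    obtain ⟨v₁, hv₁, hvm₁, hd₁⟩ := step h₁ hh₁ hm₁
    obtain ⟨v₂, hv₂, hvm₂, hd₂⟩ := step h₂ hh₂ hm₂
    obtain ⟨hc, hp⟩ := continuous_periodic_comp_iterate hF.continuous hlift hg hgper k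
    simp only [Function.iterate_succ_apply]
    rw [hd₁ _ hc hp, hd₂ _ hc hp, add_sub_add_right_eq_sub, ← mul_sub, abs_mul,
      abs_of_nonneg (by linarith : 0 ≤ 1 - ε), pow_succ]
    have := mul_le_mul_of_nonneg_left (ih v₁ v₂ hv₁ hv₂ hvm₁ hvm₂ g hg hgper M hM)
      (by linarith : 0 ≤ 1 - ε)
    linarith

/-- Exponential decay of correlations for a centred observable. -/
lemma exists_correlation_decay {F : ℝ → ℝ} (hF : ContDiff ℝ (⊤ : ℕ∞) F) {d : ℤ}
    (hlift : ∀ x, F (x + 1) = F x + d) {lam : ℝ} (hlam : 1 < lam)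
    (hexp : ∀ x, lam ≤ deriv F x) {ρ : ℝ → ℝ} (hρper : Function.Periodic ρ 1)
    (hρC1 : ContDiff ℝ 1 ρ) (hρpos : ∀ x, 0 < ρ x) (hρnorm : (∫ x in (0 : ℝ)..1, ρ x) = 1)
    {b : ℝ → ℝ} (hb : ContDiff ℝ 1 b) (hbper : Function.Periodic b 1)
    (hbmean : (∫ x in (0 : ℝ)..1, b x * ρ x) = 0) :
    ∃ K κ, 0 < K ∧ 0 < κ ∧ κ < 1 ∧
      ∀ k : ℕ, |∫ x in (0 : ℝ)..1, b x * b (F^[k] x) * ρ x| ≤ K * κ ^ k := by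
  obtain ⟨M, hM0, hM⟩ := hbper.exists_abs_le hb.continuous
  have hM1 : 0 < M + 1 := by linarith
  obtain ⟨A₁, -, hA₁⟩ := exists_isLogLipschitz hρC1 hρper hρpos
  obtain ⟨A₂, -, hA₂⟩ := exists_isLogLipschitz (h := fun x => (b x + (M + 1)) * ρ x)
    ((hb.add contDiff_const).mul hρC1) (fun x => by simp only [hbper x, hρper x])
    (fun x => mul_pos (by linarith [neg_abs_le (b x), hM x]) (hρpos x))
  obtain ⟨κ, hκ0, hκ1, hκ⟩ := exists_memory_loss hF hlift hlam hexp (max A₁ A₂)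
  have hbρ : IntervalIntegrable (fun x => b x * ρ x) volume 0 1 :=
    (hb.continuous.mul hρC1.continuous).intervalIntegrable _ _
  have hmean : (∫ x in (0 : ℝ)..1, (M + 1)⁻¹ * ((b x + (M + 1)) * ρ x)) = 1 := by
    simp only [add_mul (b _)]
    rw [intervalIntegral.integral_const_mul, intervalIntegral.integral_add hbρ
      ((hρC1.continuous.const_mul _).intervalIntegrable _ _), hbmean,
      intervalIntegral.integral_const_mul, hρnorm]
    field_simp
    ring
  refine ⟨(M + 1) * (2 * (M + 1)), κ, by positivity, hκ0, hκ1, fun k => ?_⟩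
  obtain ⟨hc, -⟩ := continuous_periodic_comp_iterate hF.continuous hlift hb.continuous hbper k
  have key := hκ k _ _ ((hA₂.mono (le_max_right _ _)).const_mul (inv_nonneg.2 hM1.le))
    (hA₁.mono (le_max_left _ _)) hmean hρnorm b hb.continuous hbper (M + 1)
    (fun x => (hM x).trans (by linarith))
  have heq : (∫ x in (0 : ℝ)..1, b x * b (F^[k] x) * ρ x) = (M + 1) *
      ((∫ x in (0 : ℝ)..1, (M + 1)⁻¹ * ((b x + (M + 1)) * ρ x) * b (F^[k] x))
        - ∫ x in (0 : ℝ)..1, ρ x * b (F^[k] x)) := by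
    rw [← intervalIntegral.integral_sub, ← intervalIntegral.integral_const_mul]
    · congr 1
      ext x
      field_simp
      ring
    · exact ((continuous_const.mul ((hb.continuous.add continuous_const).mul
        hρC1.continuous)).mul hc).intervalIntegrable _ _
    · exact (hρC1.continuous.mul hc).intervalIntegrable _ _
  rw [heq, abs_mul, abs_of_pos hM1]
  calc _ ≤ (M + 1) * (2 * (M + 1) * κ ^ k) := mul_le_mul_of_nonneg_left key hM1.le
    _ = _ := by ring

/-- The second moment of Birkhoff sums grows by a partial Green–Kubo sum at each step. -/
lemma integral_birkhoff_sq_succ {F : ℝ → ℝ} (hF : Continuous F) {d : ℤ}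
    (hlift : ∀ x, F (x + 1) = F x + d) {ρ : ℝ → ℝ} (hρ : Continuous ρ)
    (hρinv : ∀ g : ℝ → ℝ, Continuous g → Function.Periodic g 1 →
        (∫ x in (0 : ℝ)..1, ρ x * g (F x)) = ∫ x in (0 : ℝ)..1, ρ x * g x)
    {b : ℝ → ℝ} (hb : Continuous b) (hbper : Function.Periodic b 1) (n : ℕ) :
    (∫ θ in (0 : ℝ)..1, (∑ k ∈ Finset.range (n + 1), b (F^[k] θ)) ^ 2 * ρ θ)
      = (∫ θ in (0 : ℝ)..1, (∑ k ∈ Finset.range n, b (F^[k] θ)) ^ 2 * ρ θ)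
        + ((∫ x in (0 : ℝ)..1, b x ^ 2 * ρ x)
          + 2 * ∑ k ∈ Finset.range n, ∫ x in (0 : ℝ)..1, b x * b (F^[k + 1] x) * ρ x) := by
  have hcp := continuous_periodic_comp_iterate hF hlift hb hbper
  have hS : Continuous fun x => ∑ k ∈ Finset.range n, b (F^[k] x) :=
    continuous_finsetSum _ fun k _ => (hcp k).1
  have hinv := hρinv (fun x => (∑ k ∈ Finset.range n, b (F^[k] x)) ^ 2) (hS.pow 2)
    (fun x => by
      have : ∀ k, b (F^[k] (x + 1)) = b (F^[k] x) := fun k => (hcp k).2 x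
      simp only [this])
  simp only [← Function.iterate_succ_apply, Nat.succ_eq_add_one] at hinv
  have hint : ∀ k, IntervalIntegrable (fun x => b x * b (F^[k + 1] x) * ρ x) volume 0 1 :=
    fun k => ((hb.mul (hcp (k + 1)).1).mul hρ).intervalIntegrable _ _
  have hS' : Continuous fun x => ∑ k ∈ Finset.range n, b (F^[k + 1] x) :=
    continuous_finsetSum _ fun k _ => (hcp (k + 1)).1
  simp only [mul_comm _ (ρ _)] at hinv hint ⊢
  rw [← hinv, ← intervalIntegral.integral_finsetSum fun k _ => hint k,
    ← intervalIntegral.integral_const_mul, ← intervalIntegral.integral_add,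
    ← intervalIntegral.integral_add]
  · congr 1
    ext x
    rw [Finset.sum_range_succ', ← Finset.mul_sum, ← Finset.mul_sum]
    simp only [Function.iterate_zero, id_eq]
    ring
  · exact (hρ.mul (hS'.pow 2)).intervalIntegrable _ _
  · refine Continuous.intervalIntegrable ?_ _ _
    exact (hρ.mul (hb.pow 2)).add (continuous_const.mul
      (continuous_finsetSum _ fun k _ => hρ.mul (hb.mul (hcp (k + 1)).1)))
  · exact (hρ.mul (hb.pow 2)).intervalIntegrable _ _
  · refine Continuous.intervalIntegrable ?_ _ _
    exact continuous_const.mul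
      (continuous_finsetSum _ fun k _ => hρ.mul (hb.mul (hcp (k + 1)).1))

/-- If the increments of `V` converge geometrically fast to `γ`, then `V n - n γ` is bounded. -/
lemma abs_sub_nat_mul_le_of_geometric {V : ℕ → ℝ} {γ K κ : ℝ} (hκ0 : 0 < κ)
    (hκ1 : κ < 1) (hV0 : V 0 = 0) (hV : ∀ n, |V (n + 1) - V n - γ| ≤ K * κ ^ n) (n : ℕ) :
    |V n - n * γ| ≤ K * (1 - κ)⁻¹ := by
  have hK : 0 ≤ K := by simpa using (abs_nonneg _).trans (hV 0)
  have key : |V n - n * γ| ≤ K * ∑ k ∈ Finset.range n, κ ^ k := by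
    induction n with
    | zero => simp [hV0]
    | succ n ih =>
      rw [Finset.sum_range_succ, mul_add]
      calc |V (n + 1) - (n + 1 : ℕ) * γ| = |(V n - n * γ) + (V (n + 1) - V n - γ)| := by
            push_cast
            ring_nf
        _ ≤ |V n - n * γ| + |V (n + 1) - V n - γ| := abs_add_le _ _
        _ ≤ _ := add_le_add ih (hV n)
  rw [← tsum_geometric_of_lt_one hκ0.le hκ1]
  exact key.trans (mul_le_mul_of_nonneg_left ((summable_geometric_of_lt_one hκ0.le hκ1).sum_le_tsum
    _ fun k _ => pow_nonneg hκ0.le k) hK)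

/-- **Convergence of the variance to `γ`**. -/
theorem variance_converges_to_gamma
    (F : ℝ → ℝ) (hF : ContDiff ℝ (⊤ : ℕ∞) F) (d : ℤ) (hFlift : ∀ x, F (x + 1) = F x + d)
    (lam : ℝ) (hlam : 1 < lam) (hexp : ∀ x, lam ≤ deriv F x)
    (ρstar : ℝ → ℝ) (hρper : Function.Periodic ρstar 1) (hρC1 : ContDiff ℝ 1 ρstar)
    (hρpos : ∀ x, 0 < ρstar x) (hρnorm : (∫ x in (0:ℝ)..1, ρstar x) = 1)
    (hρinv : ∀ g : ℝ → ℝ, Continuous g → Function.Periodic g 1 →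
        (∫ x in (0:ℝ)..1, ρstar x * g (F x)) = ∫ x in (0:ℝ)..1, ρstar x * g x)
    (b : ℝ → ℝ) (hb : ContDiff ℝ (⊤ : ℕ∞) b) (hbper : Function.Periodic b 1)
    (hbmean : (∫ x in (0:ℝ)..1, b x * ρstar x) = 0) :
    Summable (fun k : ℕ => |∫ x in (0:ℝ)..1, b x * b (F^[k + 1] x) * ρstar x|) ∧
    ∃ C : ℝ, 0 < C ∧
      ∀ n : ℕ, 1 ≤ n →
        |(n : ℝ)⁻¹ * (∫ θ in (0:ℝ)..1, (∑ k ∈ Finset.range n, b (F^[k] θ)) ^ 2 * ρstar θ)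
            - gammaCoef F b ρstar|
          ≤ C / n := by
  have hb1 : ContDiff ℝ 1 b := hb.of_le (by exact_mod_cast le_top)
  obtain ⟨K, κ, hK, hκ0, hκ1, hdecay⟩ := exists_correlation_decay hF hFlift hlam hexp hρper hρC1
    hρpos hρnorm hb1 hbper hbmean
  set c : ℕ → ℝ := fun k => ∫ x in (0 : ℝ)..1, b x * b (F^[k + 1] x) * ρstar x with hc
  have hcle : ∀ k, ‖c k‖ ≤ K * κ * κ ^ k := fun k =>
    (hdecay (k + 1)).trans_eq (by ring)
  have hsum : Summable fun k => ‖c k‖ := Summable.of_nonneg_of_le (fun _ => norm_nonneg _) hcle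
    ((summable_geometric_of_lt_one hκ0.le hκ1).mul_left _)
  refine ⟨hsum, 2 * (K * κ / (1 - κ)) * (1 - κ)⁻¹, ?_, fun n hn => ?_⟩
  · have : 0 < 1 - κ := by linarith
    positivity
  have hn0 : (0 : ℝ) < n := by exact_mod_cast hn
  set V : ℕ → ℝ := fun n =>
    ∫ θ in (0 : ℝ)..1, (∑ k ∈ Finset.range n, b (F^[k] θ)) ^ 2 * ρstar θ with hV
  have hstep : ∀ n, |V (n + 1) - V n - gammaCoef F b ρstar|
      ≤ 2 * (K * κ / (1 - κ)) * κ ^ n := by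
    intro n
    have h1 : V (n + 1) = _ := integral_birkhoff_sq_succ hF.continuous hFlift hρC1.continuous
      hρinv hb.continuous hbper n
    have h2 := norm_sub_le_of_geometric_bound_of_hasSum hκ1 hcle hsum.of_norm.hasSum n
    have h3 : V (n + 1) - V n - gammaCoef F b ρstar
        = 2 * (∑ k ∈ Finset.range n, c k - ∑' k, c k) := by
      rw [h1, gammaCoef]
      ring
    rw [h3, abs_mul, abs_two]
    calc _ ≤ 2 * (K * κ * κ ^ n / (1 - κ)) := mul_le_mul_of_nonneg_left h2 zero_le_two
      _ = _ := by ring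
  have key := abs_sub_nat_mul_le_of_geometric hκ0 hκ1 (by simp [hV]) hstep n
  have heq : (n : ℝ)⁻¹ * V n - gammaCoef F b ρstar
      = (V n - n * gammaCoef F b ρstar) / n := by
    field_simp
  rw [heq, abs_div, abs_of_pos hn0]
  exact div_le_div_of_nonneg_right key hn0.le

end
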